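/- arXiv:2604.16124 — 2 statements merged into one kernel-verified Lean document; each statement's English description precedes it below -/
import Mathlib

section
/- Let ρ : G × ℝ → ℝ be an arbitrary function, let T_min ≤ T_max be real numbers, let α > 0, and let ρ̃ be the penalized objective. If (K*, T*) ∈ G × ℝ is a local minimizer of ρ̃ (with respect to the product topology), then T_min ≤ T* ≤ T_max and (K*, T*) is a local minimizer of the restriction of ρ to the feasible set S = {(K, T) ∈ G × ℝ : T_min ≤ T ≤ T_max}. -/
/-- The gain space `G`: triples of `m × p` real matrices `(K_p, K_i, K_d)`. -/
abbrev Gain (m p : ℕ) : Type :=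
  Matrix (Fin m) (Fin p) ℝ × Matrix (Fin m) (Fin p) ℝ × Matrix (Fin m) (Fin p) ℝ

/-- The penalized objective `ρ̃` associated with `ρ`, bounds `T_min ≤ T_max` and
penalty coefficient `α`. -/
noncomputable def penalized {m p : ℕ} (ρ : Gain m p × ℝ → ℝ) (Tmin Tmax α : ℝ) :
    Gain m p × ℝ → ℝ :=
  fun KT =>
    if KT.2 < Tmin then ρ (KT.1, Tmin) + α * (Tmin - KT.2)
    else if Tmax < KT.2 then ρ (KT.1, Tmax) + α * (KT.2 - Tmax)
    else ρ KT

theorem penalized_of_mem {m p : ℕ} (ρ : Gain m p × ℝ → ℝ) {Tmin Tmax : ℝ} (α : ℝ)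
    {KT : Gain m p × ℝ} (h : Tmin ≤ KT.2 ∧ KT.2 ≤ Tmax) :
    penalized ρ Tmin Tmax α KT = ρ KT := by
  simp [penalized, h.1.not_gt, h.2.not_gt]

theorem IsLocalMin.section_snd {X Y : Type*} [TopologicalSpace X] [TopologicalSpace Y]
    {f : X × Y → ℝ} {x : X} {y : Y} (h : IsLocalMin f (x, y)) :
    ∀ᶠ z in nhds y, f (x, y) ≤ f (x, z) :=
  (Continuous.prodMk_right x).continuousAt.eventually h

/-- If `(K*, T*)` is a local minimizer of the penalized objective `ρ̃`, then
`T_min ≤ T* ≤ T_max` and `(K*, T*)` is a local minimizer of `ρ` restricted to the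
feasible set `S = {(K, T) : T_min ≤ T ≤ T_max}`. -/
theorem localMin_penalized_is_localMinOn_feasible {m p : ℕ}
    (ρ : Gain m p × ℝ → ℝ) (Tmin Tmax α : ℝ) (hT : Tmin ≤ Tmax) (hα : 0 < α)
    (Kstar : Gain m p) (Tstar : ℝ)
    (hmin : IsLocalMin (penalized ρ Tmin Tmax α) (Kstar, Tstar)) :
    Tmin ≤ Tstar ∧ Tstar ≤ Tmax ∧
      IsLocalMinOn ρ {KT : Gain m p × ℝ | Tmin ≤ KT.2 ∧ KT.2 ≤ Tmax} (Kstar, Tstar) := by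
  have hslice := hmin.section_snd
  have hlow : Tmin ≤ Tstar := by
    by_contra! hlt
    obtain ⟨T, hle, hT₁, hT₂⟩ :=
      ((hslice.filter_mono nhdsWithin_le_nhds).and (Ioo_mem_nhdsGT hlt)).exists
    simp only [penalized, if_pos hlt, if_pos hT₂] at hle
    nlinarith
  have hupp : Tstar ≤ Tmax := by
    by_contra! hgt
    obtain ⟨T, hle, hT₁, hT₂⟩ :=
      ((hslice.filter_mono nhdsWithin_le_nhds).and (Ioo_mem_nhdsLT hgt)).exists
    simp only [penalized, if_pos hgt, if_pos hT₁, if_neg (hT.trans_lt hgt).not_gt,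
      if_neg (hT.trans_lt hT₁).not_gt] at hle
    nlinarith
  refine ⟨hlow, hupp, ?_⟩
  filter_upwards [hmin.filter_mono nhdsWithin_le_nhds, self_mem_nhdsWithin] with KT hle hKT
  rwa [penalized_of_mem ρ α ⟨hlow, hupp⟩, penalized_of_mem ρ α hKT] at hle
end

section
/- For every real r > 0, define g_r : ℂ → ℂ by g_r(s) = (1 − Complex.exp(−r·s))/(r·s) for s ≠ 0 and g_r(0) = 1 (the removable-singularity extension). Then the supremum of ‖g_r(s)‖ over all s ∈ ℂ with 0 ≤ Re(s) equals 1; that is, the H∞-norm of L₂(·; r) over the closed right half-plane equals 1 for every r > 0. -/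
/-- The finite-difference transfer function `L₂(s; r) = (1 - e^{-rs})/(rs)`,
extended by the value `1` at `s = 0` (removable singularity). -/
noncomputable def finiteDiffTF (r : ℝ) (s : ℂ) : ℂ :=
  if s = 0 then 1 else (1 - Complex.exp (-(r * s))) / (r * s)

theorem Complex.norm_one_sub_exp_neg_le {z : ℂ} (hz : 0 ≤ z.re) :
    ‖1 - Complex.exp (-z)‖ ≤ ‖z‖ := by
  have hconv : Convex ℝ {w : ℂ | 0 ≤ w.re} := convex_halfSpace_re_ge 0
  have hderiv : ∀ w ∈ {w : ℂ | 0 ≤ w.re},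
      HasDerivWithinAt (fun w : ℂ => Complex.exp (-w)) (-Complex.exp (-w))
        {w : ℂ | 0 ≤ w.re} w := fun w _ => by
    simpa using ((hasDerivAt_neg w).cexp).hasDerivWithinAt
  have hbound : ∀ w ∈ {w : ℂ | 0 ≤ w.re}, ‖-Complex.exp (-w)‖ ≤ 1 := fun w hw => by
    simpa [Complex.norm_exp] using hw
  simpa using hconv.norm_image_sub_le_of_norm_hasDerivWithin_le hderiv hbound
    (x := z) (y := 0) hz (by simp)

/-- For every `r > 0`, the H∞-norm of `L₂(·; r)` over the closed right half-plane
equals `1`: the supremum of `‖g_r(s)‖` over `Re s ≥ 0` is attained and equals `1`. -/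
theorem hinf_norm_finiteDiffTF_eq_one (r : ℝ) (hr : 0 < r) :
    IsGreatest ((fun s : ℂ => ‖finiteDiffTF r s‖) '' {s : ℂ | 0 ≤ s.re}) 1 := by
  constructor
  · exact ⟨0, by simp, by simp [finiteDiffTF]⟩
  · rintro _ ⟨s, hs, rfl⟩
    by_cases h : s = 0
    · simp [finiteDiffTF, h]
    · have hre : 0 ≤ ((r : ℂ) * s).re := by
        simpa using mul_nonneg hr.le hs
      simpa only [finiteDiffTF, if_neg h, norm_div] using
        div_le_one_of_le₀ (Complex.norm_one_sub_exp_neg_le hre) (norm_nonneg _)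
end
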